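/- arXiv:2010.07365 — 6 statements merged into one kernel-verified Lean document; each statement's English description precedes it below -/
import Mathlib

section
/- Let h be a positive integer and let P, Q ∈ K₃[T] be monic polynomials of degree h, each satisfying the functional equation (−1)^h · P(1 − T) = P^{σ₃}(T) and (−1)^h · Q(1 − T) = Q^{σ₃}(T), where P^{σ₃} denotes the polynomial obtained by applying σ₃ to each coefficient and P(1 − T) the composition with 1 − T. Let R = Res(P, Q) ∈ K₃ be their resultant (the determinant of the Sylvester matrix of P and Q). Then σ₃(R) = (−1)^h · R; in particular R² lies in the image of F in K₃. -/
open TensorProduct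

set_option synthInstance.maxHeartbeats 1000000
set_option maxHeartbeats 2000000

universe u

/-- `τ₃ = σ₁ ⊗ σ₂` on `K = K₁ ⊗[F] K₂`. -/
noncomputable def tau3 {F : Type u} [Field F] {K₁ K₂ : Type u}
    [CommRing K₁] [CommRing K₂] [Algebra F K₁] [Algebra F K₂]
    (σ₁ : K₁ ≃ₐ[F] K₁) (σ₂ : K₂ ≃ₐ[F] K₂) :
    (K₁ ⊗[F] K₂) ≃ₐ[F] (K₁ ⊗[F] K₂) :=
  Algebra.TensorProduct.congr σ₁ σ₂

/-- `τ₁ = id ⊗ σ₂` on `K = K₁ ⊗[F] K₂`. -/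
noncomputable def tau1 {F : Type u} [Field F] {K₁ K₂ : Type u}
    [CommRing K₁] [CommRing K₂] [Algebra F K₁] [Algebra F K₂]
    (σ₂ : K₂ ≃ₐ[F] K₂) :
    (K₁ ⊗[F] K₂) ≃ₐ[F] (K₁ ⊗[F] K₂) :=
  Algebra.TensorProduct.congr AlgEquiv.refl σ₂

/-- `K₃ ⊆ K₁ ⊗[F] K₂`, the subalgebra of `τ₃`-fixed elements. -/
noncomputable def K3 {F : Type u} [Field F] {K₁ K₂ : Type u}
    [CommRing K₁] [CommRing K₂] [Algebra F K₁] [Algebra F K₂]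
    (σ₁ : K₁ ≃ₐ[F] K₁) (σ₂ : K₂ ≃ₐ[F] K₂) : Subalgebra F (K₁ ⊗[F] K₂) :=
  AlgHom.equalizer (tau3 σ₁ σ₂).toAlgHom (AlgHom.id F _)

/-- The Sylvester matrix of `P` and `Q`, regarded as polynomials of degrees `m`
and `n` respectively: an `(n + m) × (n + m)` matrix whose first `n` rows are the
shifted coefficient sequences of `P` (in descending order) and whose last `m`
rows are the shifted coefficient sequences of `Q`. -/
def sylvesterMatrix {R : Type*} [CommRing R] (m n : ℕ) (P Q : Polynomial R) :
    Matrix (Fin (n + m)) (Fin (n + m)) R :=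
  Matrix.of fun i j =>
    if (i : ℕ) < n then
      (if (i : ℕ) ≤ (j : ℕ) ∧ (j : ℕ) ≤ (i : ℕ) + m then P.coeff (m + i - j) else 0)
    else
      (if (i : ℕ) - n ≤ (j : ℕ) ∧ (j : ℕ) ≤ ((i : ℕ) - n) + n then
        Q.coeff (n + ((i : ℕ) - n) - j) else 0)

/-- The resultant of `P` and `Q`, regarded as polynomials of degrees `m` and
`n`: the determinant of their Sylvester matrix. -/
def resultantOf {R : Type*} [CommRing R] (m n : ℕ) (P Q : Polynomial R) : R :=
  (sylvesterMatrix m n P Q).det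

open Polynomial in
theorem sylv_eq {R : Type*} [CommRing R] (h : ℕ) (P Q : R[X]) :
    sylvesterMatrix h h P Q = ((sylvester P Q h h).transpose).submatrix Fin.rev Fin.rev := by
  ext i j
  obtain ⟨i, rfl⟩ := Fin.rev_surjective i
  obtain ⟨j, rfl⟩ := Fin.rev_surjective j
  simp only [Matrix.submatrix_apply, Matrix.transpose_apply, Fin.rev_rev, sylvesterMatrix,
    sylvester, Matrix.of_apply, Fin.val_rev, Set.mem_Icc]
  have hj := j.isLt
  induction i using Fin.addCases with
  | left i =>
    have hi := i.isLt
    rw [Fin.addCases_left, if_neg (by simp only [Fin.val_castAdd]; omega)]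
    simp only [Fin.val_castAdd]
    congr 1
    · apply propext; omega
    · congr 1; omega
  | right i =>
    have hi := i.isLt
    rw [Fin.addCases_right, if_pos (by simp only [Fin.val_natAdd]; omega)]
    simp only [Fin.val_natAdd]
    congr 1
    · apply propext; omega
    · congr 1; omega

open Polynomial in
theorem resultantOf_eq {R : Type*} [CommRing R] (h : ℕ) (P Q : R[X]) :
    resultantOf h h P Q = resultant P Q h h := by
  rw [resultantOf, sylv_eq, resultant]
  have := Matrix.det_submatrix_equiv_self (Fin.revPerm (n := h + h)) (sylvester P Q h h).transpose
  rw [Matrix.det_transpose] at this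
  exact this

open Polynomial in
theorem comp_eq_scale {R : Type*} [CommRing R] (P : R[X]) :
    (-1) ^ P.natDegree * P.comp (1 - X) = (P.taylor 1).scaleRoots (-1) := by
  have key : ∀ G : R[X], (-1) ^ G.natDegree * G.comp (-X) = G.scaleRoots (-1) := by
    intro G
    ext i
    have hc : ((-1 : R[X]) ^ G.natDegree) = C ((-1) ^ G.natDegree) := by simp
    have hx : (-X : R[X]) = C (-1) * X := by simp
    rw [hc, hx, coeff_C_mul, comp_C_mul_X_coeff, coeff_scaleRoots]
    by_cases hi : i ≤ G.natDegree
    · obtain ⟨k, hk⟩ := Nat.exists_eq_add_of_le hi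
      rw [hk, Nat.add_sub_cancel_left, pow_add]
      have : ((-1 : R) ^ i) * (-1) ^ i = 1 := by rw [← mul_pow]; simp
      linear_combination (G.coeff i * (-1) ^ k) * this
    · rw [coeff_eq_zero_of_natDegree_lt (by omega)]; simp
  rw [← key, natDegree_taylor, taylor_apply, comp_assoc]
  congr 2
  simp
  ring

open Polynomial in
theorem resultant_fe {R : Type*} [CommRing R] (h : ℕ) (P Q : R[X])
    (hP : P.natDegree = h) (hQ : Q.natDegree = h) :
    resultant ((-1) ^ h * P.comp (1 - X)) ((-1) ^ h * Q.comp (1 - X)) h h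
      = (-1) ^ h * resultant P Q h h := by
  have h1 := resultant_scaleRoots (P.taylor 1) (Q.taylor 1) (-1)
  rw [resultant_taylor, ← comp_eq_scale, ← comp_eq_scale] at h1
  have e1 : ((-1) ^ P.natDegree * P.comp (1 - X)).natDegree = h := by
    rw [comp_eq_scale, natDegree_scaleRoots, natDegree_taylor, hP]
  have e2 : ((-1) ^ Q.natDegree * Q.comp (1 - X)).natDegree = h := by
    rw [comp_eq_scale, natDegree_scaleRoots, natDegree_taylor, hQ]
  rw [e1, e2, natDegree_taylor, natDegree_taylor, hP, hQ] at h1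
  rw [h1]
  congr 1
  rcases Nat.even_or_odd h with hh | hh
  · rw [hh.neg_one_pow, (hh.mul_left h).neg_one_pow]
  · rw [hh.neg_one_pow, (hh.mul hh).neg_one_pow]

theorem neg_one_pow_mul_sq {R : Type*} [CommRing R] (h : ℕ) (x : R) :
    ((-1) ^ h * x) ^ 2 = x ^ 2 := by
  rw [mul_pow, ← pow_mul, mul_comm h 2, pow_mul]
  simp

theorem fixed_mem {F : Type u} [Field F] {K₁ K₂ : Type u}
    [CommRing K₁] [CommRing K₂] [Algebra F K₁] [Algebra F K₂] [Nontrivial K₂]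
    (σ₁ : K₁ ≃ₐ[F] K₁) (σ₂ : K₂ ≃ₐ[F] K₂)
    (hσ₁fix : ∀ x : K₁, σ₁ x = x ↔ ∃ a : F, algebraMap F K₁ a = x)
    (hσ₂fix : ∀ x : K₂, σ₂ x = x ↔ ∃ a : F, algebraMap F K₂ a = x)
    (c : K₁ ⊗[F] K₂) (h1 : tau1 σ₂ c = c) (h3 : tau3 σ₁ σ₂ c = c) :
    ∃ a : F, algebraMap F (K₁ ⊗[F] K₂) a = c := by
  let b := Module.Basis.ofVectorSpace F K₁
  classical
  let e := TensorProduct.equivFinsuppOfBasisLeft (N := K₂) b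
  have he : ∀ c i, e (tau1 σ₂ c) i = σ₂ (e c i) := by
    intro c i
    induction c using TensorProduct.induction_on with
    | zero => simp
    | tmul x y => simp [e, tau1, TensorProduct.equivFinsuppOfBasisLeft_apply_tmul_apply]
    | add x y hx hy => simp only [map_add, Finsupp.add_apply, hx, hy]
  have hf : ∀ i, ∃ a : F, algebraMap F K₂ a = e c i := by
    intro i
    rw [← hσ₂fix, ← he, h1]
  choose a ha using hf
  obtain ⟨x, hx⟩ : ∃ x : K₁, c = x ⊗ₜ[F] (1 : K₂) := by
    refine ⟨∑ i ∈ (e c).support, a i • b i, ?_⟩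
    have hc : c = e.symm (e c) := by simp
    rw [TensorProduct.sum_tmul]
    conv_lhs => rw [hc]
    rw [TensorProduct.equivFinsuppOfBasisLeft_symm_apply, Finsupp.sum]
    refine Finset.sum_congr rfl fun i _ => ?_
    rw [← ha, Algebra.algebraMap_eq_smul_one, TensorProduct.tmul_smul, TensorProduct.smul_tmul']
  subst hx
  have h3' : (σ₁ x) ⊗ₜ[F] (1 : K₂) = x ⊗ₜ[F] (1 : K₂) := by simpa [tau3] using h3
  have hinj := Algebra.TensorProduct.includeLeft_injective (R := F) (S := F) (A := K₁) (B := K₂)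
    (algebraMap F K₂).injective
  obtain ⟨r, hr⟩ := (hσ₁fix x).1 (hinj h3')
  exact ⟨r, by rw [← hr]; rfl⟩

/-- If `P, Q ∈ K₃[T]` are monic of degree `h` and each satisfies the functional
equation `(−1)^h·P(1 − T) = P^{σ₃}(T)`, then their resultant `R` satisfies
`σ₃(R) = (−1)^h·R`; in particular `R²` lies in the image of `F` in `K₃`. -/
theorem resultant_functional_equation
    (F : Type u) [Field F] (K₁ K₂ : Type u)
    [CommRing K₁] [CommRing K₂] [Algebra F K₁] [Algebra F K₂]
    [Algebra.Etale F K₁] [Algebra.Etale F K₂]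
    (hdim₁ : Module.finrank F K₁ = 2) (hdim₂ : Module.finrank F K₂ = 2)
    (σ₁ : K₁ ≃ₐ[F] K₁) (σ₂ : K₂ ≃ₐ[F] K₂)
    (hσ₁ : ∀ x : K₁, σ₁ (σ₁ x) = x) (hσ₂ : ∀ x : K₂, σ₂ (σ₂ x) = x)
    (hσ₁fix : ∀ x : K₁, σ₁ x = x ↔ ∃ a : F, algebraMap F K₁ a = x)
    (hσ₂fix : ∀ x : K₂, σ₂ x = x ↔ ∃ a : F, algebraMap F K₂ a = x)
    -- `σ₃`, the restriction of `τ₁ = id ⊗ σ₂` to `K₃`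
    (σ₃ : K3 σ₁ σ₂ ≃ₐ[F] K3 σ₁ σ₂)
    (hσ₃ : ∀ c : K3 σ₁ σ₂, ((σ₃ c : K3 σ₁ σ₂) : K₁ ⊗[F] K₂) = tau1 σ₂ (c : K₁ ⊗[F] K₂))
    (h : ℕ) (hh : 0 < h)
    (P Q : Polynomial (K3 σ₁ σ₂))
    (hPmonic : P.Monic) (hPdeg : P.natDegree = h)
    (hQmonic : Q.Monic) (hQdeg : Q.natDegree = h)
    (hPfe : (-1 : Polynomial (K3 σ₁ σ₂)) ^ h * P.comp (1 - Polynomial.X)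
      = P.map σ₃.toAlgHom.toRingHom)
    (hQfe : (-1 : Polynomial (K3 σ₁ σ₂)) ^ h * Q.comp (1 - Polynomial.X)
      = Q.map σ₃.toAlgHom.toRingHom) :
    σ₃ (resultantOf h h P Q) = (-1 : K3 σ₁ σ₂) ^ h * resultantOf h h P Q ∧
    ∃ a : F, algebraMap F (K3 σ₁ σ₂) a = (resultantOf h h P Q) ^ 2 := by
  have hR : σ₃ (resultantOf h h P Q) = (-1 : K3 σ₁ σ₂) ^ h * resultantOf h h P Q := by
    rw [resultantOf_eq, ← resultant_fe h P Q hPdeg hQdeg, hPfe, hQfe,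
      Polynomial.resultant_map_map]
    rfl
  refine ⟨hR, ?_⟩
  have hR2 : σ₃ ((resultantOf h h P Q) ^ 2) = (resultantOf h h P Q) ^ 2 := by
    rw [map_pow, hR]
    exact neg_one_pow_mul_sq h _
  generalize (resultantOf h h P Q) ^ 2 = c at hR2
  have : Nontrivial K₂ := Module.nontrivial_of_finrank_pos (R := F) (by omega)
  obtain ⟨a, ha⟩ := fixed_mem σ₁ σ₂ hσ₁fix hσ₂fix (c : K₁ ⊗[F] K₂)
    (by rw [← hσ₃, hR2]) c.2
  exact ⟨a, Subtype.ext ha⟩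
end

section
/- Let E be a field, n and m positive integers, a an n×n matrix over E and b an m×m matrix over E. Then the resultant of the characteristic polynomials of a and b equals the determinant of the nm×nm matrix a ⊗ I_m − I_n ⊗ b, where ⊗ denotes the Kronecker product of matrices and I_k the k×k identity matrix: Res(charpoly(a), charpoly(b)) = det(a ⊗ I_m − I_n ⊗ b). -/
open Kronecker

open Polynomial in
lemma resultantOf_eq_resultant {R : Type*} [CommRing R] (m n : ℕ) (P Q : Polynomial R) :
    resultantOf m n P Q = Polynomial.resultant P Q m n := by
  unfold resultantOf Polynomial.resultant
  rw [← Matrix.det_transpose (Polynomial.sylvester P Q m n),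
    ← Matrix.det_submatrix_equiv_self (Fin.revPerm.trans (finCongr (add_comm n m)))]
  congr 1
  ext i j
  have key : ∀ (r : Fin (m + n)) (c : Fin (m + n)), (r : ℕ) = n + m - 1 - i →
      (c : ℕ) = n + m - 1 - j →
      sylvesterMatrix m n P Q i j = Polynomial.sylvester P Q m n c r := by
    intro r c hr hc
    have hi := i.2
    have hj := j.2
    induction r using Fin.addCases with
    | left r =>
      have h1 := r.2
      simp only [Fin.val_castAdd] at hr
      simp only [sylvesterMatrix, Polynomial.sylvester, Matrix.of_apply, Fin.addCases_left,
        Set.mem_Icc]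
      rw [if_neg (by omega)]
      have e : n + ((i : ℕ) - n) - j = c - r := by omega
      rw [e]
      exact if_congr (by omega) rfl rfl
    | right r =>
      have h1 := r.2
      simp only [Fin.val_natAdd] at hr
      simp only [sylvesterMatrix, Polynomial.sylvester, Matrix.of_apply, Fin.addCases_right,
        Set.mem_Icc]
      rw [if_pos (by omega)]
      by_cases h : (i : ℕ) ≤ j ∧ (j : ℕ) ≤ i + m
      · rw [if_pos h, if_pos (by omega)]
        congr 1
        omega
      · rw [if_neg h, if_neg (by omega)]
  rw [Matrix.submatrix_apply, Matrix.transpose_apply]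
  apply key
  · simp [Fin.val_rev]; omega
  · simp [Fin.val_rev]; omega

open Polynomial in
lemma det_aeval_of_splits {K : Type*} [Field K] (m : ℕ) (g : K[X]) (hg : g.Monic)
    (hs : g.Splits) (b : Matrix (Fin m) (Fin m) K) :
    (aeval b g).det = (-1) ^ (m * g.natDegree) * (g.roots.map b.charpoly.eval).prod := by
  have hx : ∀ s : Multiset K, (aeval b (s.map fun x => X - C x).prod).det
      = (-1) ^ (m * s.card) * (s.map b.charpoly.eval).prod := by
    intro s
    induction s using Multiset.induction_on with
    | empty => simp
    | cons x s ih =>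
      have : (aeval b (X - C x)).det = (-1) ^ m * b.charpoly.eval x := by
        rw [Matrix.eval_charpoly, ← neg_sub, map_neg, Matrix.det_neg, Fintype.card_fin]
        congr 2
        simp [Matrix.scalar_apply, Matrix.algebraMap_eq_diagonal]
      rw [Multiset.map_cons, Multiset.prod_cons, map_mul, Matrix.det_mul, ih, this]
      simp only [Multiset.card_cons, Multiset.map_cons, Multiset.prod_cons]
      ring
  have := hx g.roots
  rw [← hs.natDegree_eq_card_roots] at this
  rw [← this, ← hs.eq_prod_roots_of_monic hg]

open Polynomial in
lemma det_kron_eq_det_aeval {K : Type*} [Field K] (n m : ℕ)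
    (a : Matrix (Fin n) (Fin n) K) (b : Matrix (Fin m) (Fin m) K) :
    Matrix.det (a ⊗ₖ (1 : Matrix (Fin m) (Fin m) K)
          - (1 : Matrix (Fin n) (Fin n) K) ⊗ₖ b)
      = (-1) ^ (n * m) * (aeval b a.charpoly).det := by
  have h := Matrix.det_det (-(Matrix.charmatrix a)) (aeval b : K[X] →ₐ[K] _).toRingHom
  rw [Matrix.det_neg, Fintype.card_fin] at h
  change (aeval b ((-1) ^ n * a.charpoly)).det = _ at h
  have e : (aeval b ((-1) ^ n * a.charpoly)).det = (-1) ^ (n * m) * (aeval b a.charpoly).det := by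
    rw [map_mul, Matrix.det_mul, map_pow, map_neg, map_one, Matrix.det_pow, Matrix.det_neg]
    simp only [Fintype.card_fin, Matrix.det_one, mul_one]
    rw [← pow_mul, mul_comm m n]
  rw [← e, h]
  congr 1
  ext ⟨i, k⟩ ⟨j, l⟩
  by_cases hij : i = j
  · subst hij
    simp [Matrix.comp_apply, Matrix.one_apply, Matrix.algebraMap_matrix_apply]
  · simp [Matrix.comp_apply, Matrix.one_apply, Matrix.algebraMap_matrix_apply, hij]

open Polynomial in
lemma main_of_splits {K : Type*} [Field K] (n m : ℕ)
    (a : Matrix (Fin n) (Fin n) K) (b : Matrix (Fin m) (Fin m) K) (hs : a.charpoly.Splits) :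
    Polynomial.resultant a.charpoly b.charpoly n m =
    Matrix.det (a ⊗ₖ (1 : Matrix (Fin m) (Fin m) K)
          - (1 : Matrix (Fin n) (Fin n) K) ⊗ₖ b) := by
  have ha : a.charpoly.natDegree = n := by simp [Matrix.charpoly_natDegree_eq_dim]
  have hb : b.charpoly.natDegree = m := by simp [Matrix.charpoly_natDegree_eq_dim]
  have h := Polynomial.resultant_eq_prod_eval a.charpoly b.charpoly m hb.le hs
  rw [ha, a.charpoly_monic.leadingCoeff, one_pow, one_mul] at h
  rw [h, det_kron_eq_det_aeval, det_aeval_of_splits m _ a.charpoly_monic hs, ha, ← mul_assoc,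
    mul_comm m n, ← mul_pow]
  simp

/-- The resultant of the characteristic polynomials of square matrices `a` and
`b` equals the determinant of `a ⊗ I − I ⊗ b`, where `⊗` is the Kronecker
product. -/
theorem resultant_charpoly_eq_det_kronecker_sub
    (E : Type*) [Field E] (n m : ℕ) (hn : 0 < n) (hm : 0 < m)
    (a : Matrix (Fin n) (Fin n) E) (b : Matrix (Fin m) (Fin m) E) :
    resultantOf n m (Matrix.charpoly a) (Matrix.charpoly b)
      = Matrix.det (a ⊗ₖ (1 : Matrix (Fin m) (Fin m) E)
          - (1 : Matrix (Fin n) (Fin n) E) ⊗ₖ b) := by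
  rw [resultantOf_eq_resultant]
  let φ := algebraMap E (AlgebraicClosure E)
  apply φ.injective
  rw [← Polynomial.resultant_map_map, ← Matrix.charpoly_map, ← Matrix.charpoly_map,
    main_of_splits _ _ _ _ (IsAlgClosed.splits _), RingHom.map_det]
  congr 1
  ext ⟨i, k⟩ ⟨j, l⟩
  simp [Matrix.one_apply, apply_ite φ]
end

section
/- Let B be a division ring, E ⊆ B a commutative subring, and σ : E → E a ring automorphism with σ ∘ σ = id and σ ≠ id. Suppose z ∈ B is a nonzero element satisfying z·x = σ(x)·z for all x ∈ E. Then there is no element a ∈ E with z² = a·σ(a). -/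
/-- In a division ring `B`, if `E` is a commutative subring, `σ` a nontrivial
involutive ring automorphism of `E`, and `z ≠ 0` satisfies `z·x = σ(x)·z` for
all `x ∈ E`, then `z²` is not of the form `a·σ(a)` with `a ∈ E`. -/
theorem zsq_not_norm
    (B : Type*) [DivisionRing B] (E : Subring B)
    (hcomm : ∀ x ∈ E, ∀ y ∈ E, x * y = y * x)
    (σ : E ≃+* E) (hσ : ∀ x : E, σ (σ x) = x) (hσne : σ ≠ RingEquiv.refl E)
    (z : B) (hz : z ≠ 0) (hzx : ∀ x : E, z * (x : B) = ((σ x : E) : B) * z) :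
    ¬ ∃ a : E, z ^ 2 = ((a : E) : B) * ((σ a : E) : B) := by
  rintro ⟨a, ha⟩
  have h1 : z * ((σ a : E) : B) = (a : B) * z := by rw [hzx, hσ]
  have h2 : (z - (a : B)) * (z + ((σ a : E) : B)) = 0 := by
    rw [sub_mul, mul_add, mul_add, h1, ← pow_two, ha]
    abel
  have hzE : z ∈ E := by
    rcases mul_eq_zero.mp h2 with h | h
    · rw [sub_eq_zero.mp h]
      exact a.2
    · rw [eq_neg_of_add_eq_zero_left h]
      exact E.neg_mem (σ a).2
  apply hσne
  ext x
  have h3 := hzx x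
  rw [hcomm z hzE x x.2] at h3
  exact (mul_right_cancel₀ hz h3).symm
end

section
/- The F-algebra homomorphism K₁ ⊗_F K₃ → K determined by x ⊗ c ↦ (x ⊗ 1)·c is bijective, and likewise the homomorphism K₂ ⊗_F K₃ → K determined by y ⊗ c ↦ (1 ⊗ y)·c is bijective. -/
open TensorProduct

set_option synthInstance.maxHeartbeats 1000000
set_option maxHeartbeats 2000000

universe u

/-- A quadratic étale algebra has a generator `θ` such that `θ - σ θ` is a unit. -/
lemma exists_gen {F : Type u} [Field F] {A : Type u} [CommRing A] [Algebra F A]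
    [Algebra.Etale F A] (hdim : Module.finrank F A = 2) (σ : A ≃ₐ[F] A)
    (hσ : ∀ x : A, σ (σ x) = x)
    (hfix : ∀ x : A, σ x = x ↔ ∃ a : F, algebraMap F A a = x) :
    ∃ θ : A, IsUnit (θ - σ θ) ∧ ∀ x : A, ∃ a b : F, x = algebraMap F A a + b • θ := by
  have hnt : Nontrivial A := Module.nontrivial_of_finrank_pos (R := F) (by omega)
  have hred : IsReduced A := Algebra.FormallyUnramified.isReduced_of_field F A
  have hex : ∃ θ : A, ∀ a : F, algebraMap F A a ≠ θ := by
    by_contra! h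
    have : Module.finrank F A ≤ 1 := by
      apply finrank_le_one (1 : A)
      intro x
      obtain ⟨a, ha⟩ := h x
      exact ⟨a, by rw [← ha, Algebra.algebraMap_eq_smul_one]⟩
    omega
  obtain ⟨θ, hθ⟩ := hex
  refine ⟨θ, ?_, ?_⟩
  · obtain ⟨d, hd⟩ := (hfix ((θ - σ θ) ^ 2)).1 (by simp only [map_pow, map_sub, hσ]; ring)
    by_cases h0 : d = 0
    · rw [h0, map_zero] at hd
      have h1 : θ - σ θ = 0 := pow_eq_zero_iff (two_ne_zero) |>.1 hd.symm
      obtain ⟨a, ha⟩ := (hfix θ).1 (sub_eq_zero.1 h1).symm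
      exact (hθ a ha).elim
    · have : IsUnit ((θ - σ θ) ^ 2) := by
        rw [← hd]; exact (IsUnit.mk0 d h0).map _
      exact (isUnit_pow_iff two_ne_zero).1 this
  · have hli : LinearIndependent F ![(1 : A), θ] := by
      rw [LinearIndependent.pair_iff' one_ne_zero]
      intro a ha
      exact hθ a (by rw [← ha, Algebra.algebraMap_eq_smul_one])
    have hfd : FiniteDimensional F A := Module.finite_of_finrank_pos (by omega)
    have hspan := hli.span_eq_top_of_card_eq_finrank' (by simp [hdim])
    intro x
    have hx : x ∈ Submodule.span F (Set.range ![(1 : A), θ]) := hspan ▸ Submodule.mem_top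
    rw [Matrix.range_cons, Matrix.range_cons, Matrix.range_empty, Set.union_empty,
      Set.singleton_union, Submodule.mem_span_pair] at hx
    obtain ⟨a, b, h⟩ := hx
    exact ⟨a, b, by rw [← h, Algebra.algebraMap_eq_smul_one]⟩

/-- Descent: multiplication `A ⊗ B^τ → B` is bijective. -/
lemma descent {F : Type u} [Field F] {A B : Type u} [CommRing A] [Algebra F A]
    [CommRing B] [Algebra F B] (σ : A ≃ₐ[F] A) (θ : A) (hu : IsUnit (θ - σ θ))
    (hs : ∀ x : A, ∃ a b : F, x = algebraMap F A a + b • θ)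
    (τ : B →ₐ[F] B) (hτ : ∀ x, τ (τ x) = x) (ι : A →ₐ[F] B) (hι : ∀ x, τ (ι x) = ι (σ x))
    (hσ : ∀ x, σ (σ x) = x)
    (S : Subalgebra F B) (hS : ∀ x, x ∈ S ↔ τ x = x) :
    Function.Bijective (Algebra.TensorProduct.productMap ι S.val) := by
  have hform : ∀ z : A ⊗[F] S, ∃ a b : S, z = (1 : A) ⊗ₜ[F] a + θ ⊗ₜ[F] b := by
    intro z
    induction z using TensorProduct.induction_on with
    | zero => exact ⟨0, 0, by simp⟩
    | tmul x c =>
      obtain ⟨a, b, rfl⟩ := hs x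
      refine ⟨a • c, b • c, ?_⟩
      rw [TensorProduct.add_tmul, Algebra.algebraMap_eq_smul_one, TensorProduct.smul_tmul,
        TensorProduct.smul_tmul]
    | add x y hx hy =>
      obtain ⟨a, b, rfl⟩ := hx
      obtain ⟨c, d, rfl⟩ := hy
      refine ⟨a + c, b + d, ?_⟩
      rw [TensorProduct.tmul_add, TensorProduct.tmul_add]
      abel
  constructor
  · rw [injective_iff_map_eq_zero]
    intro z hz
    obtain ⟨a, b, rfl⟩ := hform z
    simp only [map_add, Algebra.TensorProduct.productMap_apply_tmul, map_one, one_mul,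
      Subalgebra.coe_val] at hz
    have h2 := congrArg τ hz
    simp only [map_add, map_mul, hι, (hS _).1 a.2, (hS _).1 b.2, map_zero] at h2
    have h3 : ι (θ - σ θ) * (b : B) = 0 := by
      rw [map_sub]; linear_combination hz - h2
    have hb : (b : B) = 0 := (hu.map ι).mul_right_eq_zero.1 h3
    have ha : (a : B) = 0 := by simpa [hb] using hz
    have hb' : b = 0 := Subtype.ext hb
    have ha' : a = 0 := Subtype.ext ha
    simp [ha', hb']
  · intro z
    obtain ⟨e, he⟩ := hu.exists_left_inv
    have htr : ∀ w, w + τ w ∈ S := fun w => by rw [hS, map_add, hτ, add_comm]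
    refine ⟨e ⊗ₜ[F] ⟨_, htr (ι θ * z)⟩ - (e * σ θ) ⊗ₜ[F] ⟨_, htr z⟩, ?_⟩
    simp only [map_sub, Algebra.TensorProduct.productMap_apply_tmul, Subalgebra.coe_val,
      map_mul, hι]
    have he' := congrArg ι he
    simp only [map_mul, map_sub, map_one] at he'
    linear_combination z * he'

/-- The multiplication maps `K₁ ⊗_F K₃ → K` (given by `x ⊗ c ↦ (x ⊗ 1)·c`) and
`K₂ ⊗_F K₃ → K` (given by `y ⊗ c ↦ (1 ⊗ y)·c`) are bijective. -/
theorem multiplication_maps_bijective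
    (F : Type u) [Field F] (K₁ K₂ : Type u)
    [CommRing K₁] [CommRing K₂] [Algebra F K₁] [Algebra F K₂]
    [Algebra.Etale F K₁] [Algebra.Etale F K₂]
    (hdim₁ : Module.finrank F K₁ = 2) (hdim₂ : Module.finrank F K₂ = 2)
    (σ₁ : K₁ ≃ₐ[F] K₁) (σ₂ : K₂ ≃ₐ[F] K₂)
    (hσ₁ : ∀ x : K₁, σ₁ (σ₁ x) = x) (hσ₂ : ∀ x : K₂, σ₂ (σ₂ x) = x)
    (hσ₁fix : ∀ x : K₁, σ₁ x = x ↔ ∃ a : F, algebraMap F K₁ a = x)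
    (hσ₂fix : ∀ x : K₂, σ₂ x = x ↔ ∃ a : F, algebraMap F K₂ a = x) :
    Function.Bijective
      (Algebra.TensorProduct.productMap
        (Algebra.TensorProduct.includeLeft : K₁ →ₐ[F] K₁ ⊗[F] K₂)
        (K3 σ₁ σ₂).val) ∧
    Function.Bijective
      (Algebra.TensorProduct.productMap
        (Algebra.TensorProduct.includeRight : K₂ →ₐ[F] K₁ ⊗[F] K₂)
        (K3 σ₁ σ₂).val) := by
  obtain ⟨θ₁, hu₁, hs₁⟩ := exists_gen hdim₁ σ₁ hσ₁ hσ₁fix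
  obtain ⟨θ₂, hu₂, hs₂⟩ := exists_gen hdim₂ σ₂ hσ₂ hσ₂fix
  have hτ : ∀ x, (tau3 σ₁ σ₂).toAlgHom ((tau3 σ₁ σ₂).toAlgHom x) = x := by
    intro x
    induction x using TensorProduct.induction_on with
    | zero => simp
    | tmul x y => simp [tau3, hσ₁, hσ₂]
    | add x y hx hy => rw [map_add, map_add, hx, hy]
  have hS : ∀ x, x ∈ K3 σ₁ σ₂ ↔ (tau3 σ₁ σ₂).toAlgHom x = x := fun x => Iff.rfl
  exact ⟨descent σ₁ θ₁ hu₁ hs₁ _ hτ _ (fun x => by simp [tau3]) hσ₁ _ hS,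
    descent σ₂ θ₂ hu₂ hs₂ _ hτ _ (fun x => by simp [tau3]) hσ₂ _ hS⟩
end

section
/- K₁ and K₂ are isomorphic as F-algebras if and only if K₃ is isomorphic as an F-algebra to F × F. -/
open TensorProduct

set_option synthInstance.maxHeartbeats 1000000
set_option maxHeartbeats 2000000

universe u

lemma q_indep {F A : Type*} [Field F] [CommRing A] [Algebra F A] [Nontrivial A] {z : A}
    (hz : ∀ a : F, algebraMap F A a ≠ z) {a b : F}
    (h : algebraMap F A a + algebraMap F A b * z = 0) : a = 0 ∧ b = 0 := by
  have hb : b = 0 := by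
    by_contra hb
    apply hz (-(b⁻¹ * a))
    have h1 : algebraMap F A b⁻¹ * algebraMap F A b = 1 := by
      rw [← map_mul, inv_mul_cancel₀ hb, map_one]
    rw [map_neg, map_mul]
    linear_combination (-algebraMap F A b⁻¹) * h + z * h1
  subst hb
  refine ⟨?_, rfl⟩
  simpa using h

lemma q_basis {F A : Type*} [Field F] [CommRing A] [Algebra F A]
    (hd : Module.finrank F A = 2) {z : A} (hz : ∀ a : F, algebraMap F A a ≠ z) :
    ∃ b : Module.Basis (Fin 2) F A, b 0 = 1 ∧ b 1 = z := by
  have : Nontrivial A := Module.nontrivial_of_finrank_pos (R := F) (by omega)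
  have hli : LinearIndependent F ![(1 : A), z] := by
    rw [LinearIndependent.pair_iff]
    intro s t h
    apply q_indep hz
    simpa [Algebra.smul_def] using h
  refine ⟨basisOfLinearIndependentOfCardEqFinrank hli (by simp [hd]), ?_, ?_⟩ <;> simp

lemma q_span {F A : Type*} [Field F] [CommRing A] [Algebra F A]
    (hd : Module.finrank F A = 2) {z : A} (hz : ∀ a : F, algebraMap F A a ≠ z) (w : A) :
    ∃ a b : F, w = algebraMap F A a + algebraMap F A b * z := by
  obtain ⟨b, h0, h1⟩ := q_basis hd hz
  refine ⟨b.repr w 0, b.repr w 1, ?_⟩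
  have := b.sum_repr w
  rw [Fin.sum_univ_two, h0, h1] at this
  simp only [Algebra.smul_def, mul_one] at this
  exact this.symm

lemma q_equiv {F A : Type*} [Field F] [CommRing A] [Algebra F A] [Nontrivial A]
    {z : A} (hz : ∀ a : F, algebraMap F A a ≠ z)
    (hs : ∀ w : A, ∃ a b : F, w = algebraMap F A a + algebraMap F A b * z)
    {d : F} (hq : z * z = z - algebraMap F A d) :
    Nonempty (QuadraticAlgebra F (-d) 1 ≃ₐ[F] A) := by
  let f : QuadraticAlgebra F (-d) 1 →ₐ[F] A :=
    QuadraticAlgebra.lift ⟨z, by rw [hq]; simp [Algebra.smul_def]; ring⟩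
  have hf : ∀ w, f w = algebraMap F A w.re + algebraMap F A w.im * z := by
    intro w
    simp [f, QuadraticAlgebra.lift, Algebra.smul_def]
  refine ⟨AlgEquiv.ofBijective f ⟨?_, ?_⟩⟩
  · rw [injective_iff_map_eq_zero]
    intro w hw
    rw [hf] at hw
    obtain ⟨h1, h2⟩ := q_indep hz hw
    ext <;> simp [h1, h2]
  · intro w
    obtain ⟨a, b, h⟩ := hs w
    exact ⟨⟨a, b⟩, by rw [hf, h]⟩

lemma q_gen {F A : Type*} [Field F] [CommRing A] [Algebra F A] [IsReduced A]
    (hd : Module.finrank F A = 2) (σ : A ≃ₐ[F] A) (hσ : ∀ x, σ (σ x) = x)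
    (hfix : ∀ x : A, σ x = x ↔ ∃ a : F, algebraMap F A a = x) :
    ∃ (z : A) (d : F), (∀ a : F, algebraMap F A a ≠ z) ∧ σ z = 1 - z ∧
      z * z = z - algebraMap F A d ∧ 1 - 4 * d ≠ 0 := by
  have : Nontrivial A := Module.nontrivial_of_finrank_pos (R := F) (by omega)
  have hinj : Function.Injective (algebraMap F A) := (algebraMap F A).injective
  obtain ⟨y, hy⟩ : ∃ y : A, ∀ a : F, algebraMap F A a ≠ y := by
    by_contra! h
    have h1 : Module.finrank F A ≤ 1 := finrank_le_one (1 : A) (by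
      intro w
      obtain ⟨a, ha⟩ := h w
      exact ⟨a, by rw [← ha, Algebra.algebraMap_eq_smul_one]⟩)
    omega
  obtain ⟨t, ht⟩ := (hfix (y + σ y)).1 (by rw [map_add, hσ, add_comm])
  obtain ⟨z, hz, hσz⟩ : ∃ z : A, (∀ a : F, algebraMap F A a ≠ z) ∧ σ z = 1 - z := by
    by_cases h0 : t = 0
    · subst h0
      have h2 : (2 : F) ≠ 0 := by
        intro h2
        have h2' : (2 : A) = 0 := by
          have := congrArg (algebraMap F A) h2
          rwa [map_ofNat, map_zero] at this
        have : σ y = y := by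
          simp only [map_zero] at ht
          linear_combination -ht - y * h2'
        obtain ⟨a, ha⟩ := (hfix y).1 this
        exact hy a ha
      have hh : algebraMap F A 2⁻¹ * 2 = 1 := by
        have := congrArg (algebraMap F A) (inv_mul_cancel₀ h2)
        simpa only [map_mul, map_ofNat, map_one] using this
      refine ⟨y + algebraMap F A 2⁻¹, fun a ha => hy (a - 2⁻¹) ?_, ?_⟩
      · rw [map_sub, ha]; ring
      · rw [map_add, AlgEquiv.commutes]
        simp only [map_zero] at ht
        linear_combination -ht + hh
    · have hh : algebraMap F A t⁻¹ * algebraMap F A t = 1 := by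
        rw [← map_mul, inv_mul_cancel₀ h0, map_one]
      refine ⟨algebraMap F A t⁻¹ * y, fun a ha => hy (t * a) ?_, ?_⟩
      · rw [map_mul, ha]; linear_combination y * hh
      · rw [map_mul, AlgEquiv.commutes]
        linear_combination -algebraMap F A t⁻¹ * ht + hh
  obtain ⟨d, hdd⟩ := (hfix (z * σ z)).1 (by rw [map_mul, hσ, mul_comm])
  have hq : z * z = z - algebraMap F A d := by
    rw [hdd, hσz]; ring
  refine ⟨z, d, hz, hσz, hq, fun hD => ?_⟩
  have hD' : 1 - 4 * algebraMap F A d = 0 := by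
    have := congrArg (algebraMap F A) hD
    rwa [map_sub, map_mul, map_ofNat, map_one, map_zero] at this
  have hn : IsNilpotent (1 - 2 * z) := ⟨2, by linear_combination 4 * hq + hD'⟩
  have h1 := hn.eq_zero
  have := q_indep hz (a := 1) (b := -2) (by
    rw [map_neg, map_ofNat, map_one]; linear_combination h1)
  exact one_ne_zero this.1

lemma q_K3 {F : Type u} [Field F] {K₁ K₂ : Type u}
    [CommRing K₁] [CommRing K₂] [Algebra F K₁] [Algebra F K₂]
    (hdim₁ : Module.finrank F K₁ = 2) (hdim₂ : Module.finrank F K₂ = 2)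
    (σ₁ : K₁ ≃ₐ[F] K₁) (σ₂ : K₂ ≃ₐ[F] K₂) {x : K₁} {y : K₂} {d₁ d₂ : F}
    (hx : ∀ a : F, algebraMap F K₁ a ≠ x) (hy : ∀ a : F, algebraMap F K₂ a ≠ y)
    (hσx : σ₁ x = 1 - x) (hσy : σ₂ y = 1 - y)
    (hqx : x * x = x - algebraMap F K₁ d₁) (hqy : y * y = y - algebraMap F K₂ d₂) :
    Nonempty (QuadraticAlgebra F (-(d₁ + d₂ - 4 * d₁ * d₂)) 1 ≃ₐ[F] K3 σ₁ σ₂) := by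
  obtain ⟨b₁, h10, h11⟩ := q_basis hdim₁ hx
  obtain ⟨b₂, h20, h21⟩ := q_basis hdim₂ hy
  let B := b₁.tensorProduct b₂
  set X : K₁ ⊗[F] K₂ := x ⊗ₜ 1 with hX
  set Y : K₁ ⊗[F] K₂ := 1 ⊗ₜ y with hY
  let c : F →+* K₁ ⊗[F] K₂ := algebraMap F _
  have B00 : B (0, 0) = 1 := by simp [B, h10, h20, Algebra.TensorProduct.one_def]
  have B10 : B (1, 0) = X := by simp [B, h11, h20, hX]
  have B01 : B (0, 1) = Y := by simp [B, h10, h21, hY]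
  have B11 : B (1, 1) = X * Y := by simp [B, h11, h21, hX, hY]
  have hspan : ∀ w, ∃ p q r s : F, w = c p + c q * X + c r * Y + c s * (X * Y) := by
    intro w
    refine ⟨B.repr w (0,0), B.repr w (1,0), B.repr w (0,1), B.repr w (1,1), ?_⟩
    have := B.sum_repr w
    simp only [Fintype.sum_prod_type, Fin.sum_univ_two, B00, B10, B01, B11,
      Algebra.smul_def, mul_one] at this
    simp only [c]
    linear_combination -this
  have hind : ∀ p q r s : F, c p + c q * X + c r * Y + c s * (X * Y) = 0 →
      p = 0 ∧ q = 0 ∧ r = 0 ∧ s = 0 := by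
    intro p q r s h
    have := Fintype.linearIndependent_iff.1 B.linearIndependent
      (fun i => ![![p, r], ![q, s]] i.1 i.2) (by
        simp only [Fintype.sum_prod_type, Fin.sum_univ_two, B00, B10, B01, B11,
          Algebra.smul_def, mul_one]
        simp only [Matrix.cons_val_zero, Matrix.cons_val_one]
        linear_combination h)
    exact ⟨by simpa using this (0,0), by simpa using this (1,0), by simpa using this (0,1),
      by simpa using this (1,1)⟩
  have hqX : X * X = X - c d₁ := by
    simp only [hX, c, Algebra.TensorProduct.tmul_mul_tmul, hqx, mul_one,
      Algebra.TensorProduct.algebraMap_apply, TensorProduct.sub_tmul]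
  have hqY : Y * Y = Y - c d₂ := by
    simp only [hY, c, Algebra.TensorProduct.tmul_mul_tmul, hqy, mul_one,
      Algebra.TensorProduct.algebraMap_apply', TensorProduct.tmul_sub]
  have hτX : tau3 σ₁ σ₂ X = 1 - X := by
    simp [tau3, hX, hσx, TensorProduct.sub_tmul, Algebra.TensorProduct.one_def]
  have hτY : tau3 σ₁ σ₂ Y = 1 - Y := by
    simp [tau3, hY, hσy, TensorProduct.tmul_sub, Algebra.TensorProduct.one_def]
  have hmem : ∀ w, w ∈ K3 σ₁ σ₂ ↔ tau3 σ₁ σ₂ w = w := fun w => Iff.rfl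
  have hτc : ∀ a, tau3 σ₁ σ₂ (c a) = c a := fun a => AlgEquiv.commutes _ a
  let Z : K3 σ₁ σ₂ := ⟨X + Y - 2 * (X * Y), by
    rw [hmem]
    simp only [map_sub, map_add, map_mul, hτX, hτY, map_ofNat]
    ring⟩
  have : Nontrivial (K₁ ⊗[F] K₂) := ⟨⟨X, 0, fun h => by
    have := hind 0 1 0 0 (by simp [h])
    exact one_ne_zero this.2.1⟩⟩
  apply q_equiv (z := Z)
  · intro a ha
    have ha' : c a = X + Y - 2 * (X * Y) := congrArg Subtype.val ha
    have := hind (-a) 1 1 (-2) (by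
      simp only [map_neg, map_one, map_ofNat]; linear_combination -ha')
    exact one_ne_zero this.2.1
  · rintro ⟨w, hw⟩
    obtain ⟨p, q, r, s, h⟩ := hspan w
    rw [hmem, h] at hw
    simp only [map_add, map_mul, hτX, hτY, hτc] at hw
    obtain ⟨e1, e2, e3, e4⟩ := hind (q + r + s) (-(2 * q) - s) (-(2 * r) - s) 0 (by
      simp only [map_neg, map_add, map_sub, map_mul, map_ofNat, map_zero]
      linear_combination hw)
    refine ⟨p, q, Subtype.ext ?_⟩
    change w = c p + c q * (X + Y - 2 * (X * Y))
    have hr : r = q := by linear_combination e1 + e2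
    have hs : s = -(2 * q) := by linear_combination -e2
    rw [h, hr, hs]
    simp only [map_neg, map_mul, map_ofNat]
    ring
  · apply Subtype.ext
    change (X + Y - 2 * (X * Y)) * (X + Y - 2 * (X * Y)) =
      X + Y - 2 * (X * Y) - c (d₁ + d₂ - 4 * d₁ * d₂)
    simp only [map_sub, map_add, map_mul, map_ofNat]
    linear_combination (1 - 4 * Y + 4 * (Y * Y)) * hqX + (1 - 4 * c d₁) * hqY

/-- `K₁ ≅ K₂` as `F`-algebras if and only if `K₃ ≅ F × F` as `F`-algebras. -/
theorem K1_iso_K2_iff_K3_split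
    (F : Type u) [Field F] (K₁ K₂ : Type u)
    [CommRing K₁] [CommRing K₂] [Algebra F K₁] [Algebra F K₂]
    [Algebra.Etale F K₁] [Algebra.Etale F K₂]
    (hdim₁ : Module.finrank F K₁ = 2) (hdim₂ : Module.finrank F K₂ = 2)
    (σ₁ : K₁ ≃ₐ[F] K₁) (σ₂ : K₂ ≃ₐ[F] K₂)
    (hσ₁ : ∀ x : K₁, σ₁ (σ₁ x) = x) (hσ₂ : ∀ x : K₂, σ₂ (σ₂ x) = x)
    (hσ₁fix : ∀ x : K₁, σ₁ x = x ↔ ∃ a : F, algebraMap F K₁ a = x)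
    (hσ₂fix : ∀ x : K₂, σ₂ x = x ↔ ∃ a : F, algebraMap F K₂ a = x) :
    Nonempty (K₁ ≃ₐ[F] K₂) ↔ Nonempty (K3 σ₁ σ₂ ≃ₐ[F] (F × F)) := by

  have : IsReduced K₁ := Algebra.FormallyUnramified.isReduced_of_field F K₁
  have : IsReduced K₂ := Algebra.FormallyUnramified.isReduced_of_field F K₂
  have : Nontrivial K₁ := Module.nontrivial_of_finrank_pos (R := F) (by omega)
  have : Nontrivial K₂ := Module.nontrivial_of_finrank_pos (R := F) (by omega)
  obtain ⟨x, d₁, hx, hσx, hqx, hD₁⟩ := q_gen hdim₁ σ₁ hσ₁ hσ₁fix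
  obtain ⟨y, d₂, hy, hσy, hqy, hD₂⟩ := q_gen hdim₂ σ₂ hσ₂ hσ₂fix
  obtain ⟨e₃⟩ := q_K3 hdim₁ hdim₂ σ₁ σ₂ hx hy hσx hσy hqx hqy
  constructor
  · rintro ⟨φ⟩
    obtain ⟨α, β, hu⟩ := q_span hdim₂ hy (φ x)
    have hβ : β ≠ 0 := by
      rintro rfl
      apply hx α
      apply φ.injective
      rw [hu]; simp
    have hq := congrArg φ hqx
    rw [map_mul, map_sub, AlgEquiv.commutes, hu] at hq
    obtain ⟨h1, h2⟩ := q_indep hy (a := α * α - β * β * d₂ - α + d₁)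
      (b := 2 * α * β + β * β - β) (by
        simp only [map_add, map_sub, map_mul, map_ofNat]
        linear_combination hq - algebraMap F K₂ β * algebraMap F K₂ β * hqy)
    have hb : β = 1 - 2 * α := by
      apply mul_left_cancel₀ hβ
      linear_combination h2
    subst hb
    have hr : 1 - 2 * (α + 2 * d₂ - 4 * α * d₂) ≠ 0 := by
      have := mul_ne_zero hβ hD₂
      intro h; apply this; linear_combination h
    generalize hrr : α + 2 * d₂ - 4 * α * d₂ = r at hr
    have hre : r * r = r - (d₁ + d₂ - 4 * d₁ * d₂) := by
      rw [← hrr]; linear_combination (1 - 4 * d₂) * h1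
    have hz : ∀ a : F, algebraMap F (F × F) a ≠ (r, 1 - r) := by
      intro a ha
      have h1 : a = r := congrArg Prod.fst ha
      have h2 : a = 1 - r := congrArg Prod.snd ha
      apply hr; linear_combination h1 - h2
    obtain ⟨e⟩ := q_equiv hz (q_span (by simp) hz) (d := d₁ + d₂ - 4 * d₁ * d₂) (by
      ext
      · exact hre
      · change (1 - r) * (1 - r) = 1 - r - (d₁ + d₂ - 4 * d₁ * d₂)
        linear_combination hre)
    exact ⟨e₃.symm.trans e⟩
  · rintro ⟨ψ⟩
    let e := e₃.trans ψ
    obtain ⟨w, hw⟩ := e.surjective (1, 0)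
    have hww : w * w = w := by
      apply e.injective
      rw [map_mul, hw]; simp
    have hw1 := congrArg QuadraticAlgebra.re hww
    have hw2 := congrArg QuadraticAlgebra.im hww
    simp only [QuadraticAlgebra.re_mul, QuadraticAlgebra.im_mul] at hw1 hw2
    have hb : w.im ≠ 0 := by
      intro h
      have : w = algebraMap F _ w.re := by
        ext <;> simp [h]
      rw [this, AlgEquiv.commutes] at hw
      have h1 : w.re = 1 := congrArg Prod.fst hw
      have h2 : w.re = 0 := congrArg Prod.snd hw
      exact one_ne_zero (h1.symm.trans h2)
    generalize w.re = a at *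
    generalize w.im = b at *
    have hba : b = 1 - 2 * a := by
      apply mul_left_cancel₀ hb
      linear_combination hw2
    subst hba
    have hβ := mul_ne_zero hD₁ hb
    generalize hα : a + 2 * d₁ - 4 * d₁ * a = α
    have hβα : (1 - 4 * d₁) * (1 - 2 * a) = 1 - 2 * α := by rw [← hα]; ring
    rw [hβα] at hβ
    have key : α * α - (1 - 2 * α) * (1 - 2 * α) * d₂ - α + d₁ = 0 := by
      rw [← hα]
      linear_combination (1 - 4 * d₁) * hw1
    have hz : ∀ t : F, algebraMap F K₂ t ≠ algebraMap F K₂ α + algebraMap F K₂ (1 - 2 * α) * y := by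
      intro t ht
      have := q_indep hy (a := α - t) (b := 1 - 2 * α) (by
        rw [map_sub]; linear_combination -ht)
      exact hβ this.2
    have hkey := congrArg (algebraMap F K₂) key
    simp only [map_add, map_sub, map_mul, map_ofNat, map_one, map_zero] at hkey
    obtain ⟨f₂⟩ := q_equiv hz (q_span hdim₂ hz) (d := d₁) (by
      simp only [map_sub, map_mul, map_ofNat, map_one]
      linear_combination hkey + (1 - 2 * algebraMap F K₂ α) * (1 - 2 * algebraMap F K₂ α) * hqy)
    obtain ⟨f₁⟩ := q_equiv hx (q_span hdim₁ hx) hqx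
    exact ⟨f₁.symm.trans f₂⟩
end

section
/- Let F be a field and let A ⊆ M₂(F) be an F-subalgebra of the 2×2 matrix algebra that is a quadratic étale F-algebra (commutative, étale over F, of dimension 2 over F), with nontrivial F-algebra automorphism σ. If z ∈ GL₂(F) satisfies z·x·z⁻¹ = σ(x) for all x ∈ A, then the F-subalgebra of M₂(F) generated by A ∪ {z} is all of M₂(F). -/
universe u

/-- If `A ⊆ M₂(F)` is a quadratic étale `F`-subalgebra (presented as the image
of an injective `F`-algebra homomorphism `ι` from a quadratic étale `F`-algebra
`L`) with nontrivial automorphism `σ`, and `z ∈ GL₂(F)` satisfies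
`z·ι(x)·z⁻¹ = ι(σ x)` for all `x`, then `A` and `z` generate `M₂(F)` as an
`F`-algebra. -/
theorem quadratic_etale_and_twist_generate_M2
    (F : Type u) [Field F]
    (L : Type u) [CommRing L] [Algebra F L]
    [Algebra.Etale F L] (hdim : Module.finrank F L = 2)
    (σ : L ≃ₐ[F] L)
    (hσ : ∀ x : L, σ (σ x) = x)
    (hσne : σ ≠ AlgEquiv.refl)
    (hσfix : ∀ x : L, σ x = x ↔ ∃ a : F, algebraMap F L a = x)
    (ι : L →ₐ[F] Matrix (Fin 2) (Fin 2) F) (hι : Function.Injective ι)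
    (z : (Matrix (Fin 2) (Fin 2) F)ˣ)
    (hz : ∀ x : L,
      (z : Matrix (Fin 2) (Fin 2) F) * ι x
          * ((z⁻¹ : (Matrix (Fin 2) (Fin 2) F)ˣ) : Matrix (Fin 2) (Fin 2) F)
        = ι (σ x)) :
    Algebra.adjoin F (Set.range ⇑ι ∪ {(z : Matrix (Fin 2) (Fin 2) F)}) = ⊤ := by
  have hred : IsReduced L := Algebra.FormallyUnramified.isReduced_of_field F L
  have hfin : Module.Finite F L := Module.finite_of_finrank_pos (by omega)
  obtain ⟨x, hx⟩ : ∃ x, σ x ≠ x := by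
    by_contra h
    push Not at h
    exact hσne (AlgEquiv.ext h)
  have hd : σ x - x ≠ 0 := sub_ne_zero.mpr hx
  obtain ⟨a, ha⟩ := (hσfix ((σ x - x) ^ 2)).1 (by rw [map_pow, map_sub, hσ]; ring)
  have ha0 : a ≠ 0 := by
    rintro rfl
    rw [map_zero] at ha
    exact hd (pow_eq_zero_iff (two_ne_zero) |>.1 ha.symm)
  have hcomm : ∀ y : L, (z : Matrix (Fin 2) (Fin 2) F) * ι y = ι (σ y) * z := by
    intro y
    rw [← hz y, mul_assoc, Units.inv_mul, mul_one]
  let f : L × L →ₗ[F] Matrix (Fin 2) (Fin 2) F :=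
    LinearMap.coprod ι.toLinearMap
      ((LinearMap.mulRight F (z : Matrix (Fin 2) (Fin 2) F)).comp ι.toLinearMap)
  have hf : ∀ u v, f (u, v) = ι u + ι v * z := fun u v => by simp [f]
  have hinj : Function.Injective f := by
    rw [injective_iff_map_eq_zero]
    rintro ⟨u, v⟩ h
    rw [hf] at h
    have h1 : (ι u + ι v * z) * ι x - ι x * (ι u + ι v * z) = ι (v * (σ x - x)) * z := by
      have e1 : ι u * ι x = ι x * ι u := by rw [← map_mul, ← map_mul, mul_comm]
      have e2 : ι v * ι x = ι x * ι v := by rw [← map_mul, ← map_mul, mul_comm]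
      rw [add_mul, mul_add, mul_assoc (ι v), hcomm, map_mul, map_sub, mul_sub, sub_mul, e1, e2]
      simp only [mul_assoc]
      abel
    rw [h, zero_mul, mul_zero, sub_zero] at h1
    have h2 : ι (v * (σ x - x)) = 0 := (Units.mul_left_eq_zero z).1 h1.symm
    have h3 : v * (σ x - x) = 0 := hι (by rw [h2, map_zero])
    have h4 : a • v = 0 := by
      rw [Algebra.smul_def, ha, mul_comm, pow_two, ← mul_assoc, h3, zero_mul]
    have hv : v = 0 := (smul_eq_zero.1 h4).resolve_left ha0
    subst hv
    have hu : u = 0 := hι (by simpa using h)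
    rw [hu]
    rfl
  have hsurj : Function.Surjective f := by
    refine (LinearMap.injective_iff_surjective_of_finrank_eq_finrank ?_).1 hinj
    rw [Module.finrank_prod, hdim, Module.finrank_matrix]
    simp
  rw [eq_top_iff]
  intro m _
  obtain ⟨⟨u, v⟩, rfl⟩ := hsurj m
  rw [hf]
  exact add_mem (Algebra.subset_adjoin (Or.inl ⟨u, rfl⟩))
    (mul_mem (Algebra.subset_adjoin (Or.inl ⟨v, rfl⟩)) (Algebra.subset_adjoin (Or.inr rfl)))
end
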